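/- Let p ≥ 1, k ≥ 1, and let α_1, ..., α_{k+1} and γ_1, ..., γ_k be complex numbers with Re(α_j) > p-1 for j = 1, ..., k+1, Re(α_j + γ_j) > p-1 for j = 1, ..., k, and Re(α_{k+1} - γ_1 - ... - γ_k) > p-1. Let f₂ be the complex matrix-variate type-2 Dirichlet density f₂(X_1,...,X_k) = D̃_k ∏_{j=1}^k det(X_j)^{α_j - p} · det(I + X_1 + ... + X_k)^{-(α_1 + ... + α_{k+1})}, with D̃_k = Γ̃_p(α_1 + ... + α_{k+1}) / ∏_{j=1}^{k+1} Γ̃_p(α_j), supported on tuples of positive definite p×p self-adjoint matrices. Then the Dirichlet average of φ₄(X_1,...,X_k) = ∏_{j=1}^k det(X_j)^{γ_j} with respect to f₂ equals ( ∏_{j=1}^k Γ̃_p(α_j + γ_j)/Γ̃_p(α_j) ) · Γ̃_p(α_{k+1} - γ_1 - ... - γ_k) / Γ̃_p(α_{k+1}). -/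

import Mathlib

open MeasureTheory Matrix
open scoped ComplexOrder

noncomputable section

/-- Parameter space `ℝ^p × ℂ^{p(p-1)/2}` for `p × p` Hermitian matrices:
the real diagonal entries together with the strictly upper-triangular complex entries. -/
abbrev HermParam (p : ℕ) : Type :=
  (Fin p → ℝ) × ({ q : Fin p × Fin p // q.1 < q.2 } → ℂ)

/-- The linear isomorphism sending the parameters to the corresponding self-adjoint matrix. -/
def toHermMatrix (p : ℕ) (T : HermParam p) : Matrix (Fin p) (Fin p) ℂ :=
  Matrix.of fun i j =>
    if h : i < j then T.2 ⟨(i, j), h⟩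
    else if h' : j < i then (starRingEnd ℂ) (T.2 ⟨(j, i), h'⟩)
    else (T.1 i : ℂ)

noncomputable instance matrixComplexMeasureSpace (m n : ℕ) :
    MeasureSpace (Matrix (Fin m) (Fin n) ℂ) :=
  inferInstanceAs (MeasureSpace (Fin m → Fin n → ℂ))

/-- The Lebesgue measure `μ_p` on Herm(p), realized as a measure on the space of
`p × p` complex matrices: the pushforward of Lebesgue measure on the parameter space
under the linear isomorphism `toHermMatrix p`. -/
def hermLebesgue (p : ℕ) : Measure (Matrix (Fin p) (Fin p) ℂ) :=
  Measure.map (toHermMatrix p) volume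

/-- The complex matrix-variate gamma function
`Γ̃_p(α) = π^{p(p-1)/2} ∏_{j=1}^p Γ(α - j + 1) = π^{p(p-1)/2} ∏_{j=0}^{p-1} Γ(α - j)`. -/
def cGammaP (p : ℕ) (α : ℂ) : ℂ :=
  (Real.pi : ℂ) ^ (p * (p - 1) / 2) * ∏ j : Fin p, Complex.Gamma (α - j)

end

theorem integral_exp_neg_norm_sq_complex :
    ∫ z : ℂ, Real.exp (-‖z‖ ^ 2) = Real.pi := by
  have h := Complex.integral_exp_neg_rpow (p := 2) (by norm_num)
  norm_num [Real.Gamma_two] at h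
  simpa using h

theorem integrable_exp_neg_norm_sq_complex :
    Integrable fun z : ℂ => Real.exp (-‖z‖ ^ 2) := by
  by_contra h
  have h' := integral_exp_neg_norm_sq_complex
  rw [integral_undef h] at h'
  exact Real.pi_ne_zero h'.symm

theorem lintegral_exp_neg_sum_norm_sq (n : ℕ) :
    ∫⁻ w : Fin n → ℂ, ENNReal.ofReal (Real.exp (-∑ i, ‖w i‖ ^ 2)) =
      ENNReal.ofReal (Real.pi ^ n) := by
  simp_rw [← Finset.sum_neg_distrib, Real.exp_sum]
  rw [← ofReal_integral_eq_lintegral_ofReal]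
  · congr 1
    have := integral_fintype_prod_volume_eq_pow (ι := Fin n)
      (fun z : ℂ => Real.exp (-‖z‖ ^ 2))
    rw [integral_exp_neg_norm_sq_complex] at this
    simpa using this
  · exact Integrable.fintype_prod (fun _ => integrable_exp_neg_norm_sq_complex)
  · exact Filter.Eventually.of_forall fun _ => Finset.prod_nonneg fun _ _ => (Real.exp_pos _).le

open scoped MatrixOrder in
theorem lintegral_exp_neg_quadratic {n : ℕ} {A : Matrix (Fin n) (Fin n) ℂ} (hA : A.PosDef) :
    ∫⁻ u : Fin n → ℂ, ENNReal.ofReal (Real.exp (-(u ⬝ᵥ A *ᵥ star u).re)) =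
      ENNReal.ofReal (Real.pi ^ n / A.det.re) := by
  obtain ⟨N, hN⟩ := CStarAlgebra.nonneg_iff_eq_star_mul_self.mp hA.posSemidef.nonneg
  have hdet : A.det.re = ‖N.det‖ ^ 2 := by
    rw [hN, det_mul, star_eq_conjTranspose, det_conjTranspose, ← Complex.normSq_eq_norm_sq]
    simp [Complex.normSq_apply]
  have hdpos : 0 < A.det.re := (Complex.pos_iff.mp hA.det_pos).1
  let L : (Fin n → ℂ) →ₗ[ℝ] (Fin n → ℂ) := (Matrix.toLin' (Nᴴ)ᵀ).restrictScalars ℝ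
  have hLdet : LinearMap.det L = A.det.re := by
    rw [LinearMap.det_restrictScalars, LinearMap.det_toLin', det_transpose, det_conjTranspose,
      hdet, Algebra.norm_complex_apply, Complex.normSq_eq_norm_sq]
    simp
  have hL0 : LinearMap.det L ≠ 0 := by rw [hLdet]; exact hdpos.ne'
  have hmap := Measure.map_linearMap_addHaar_eq_smul_addHaar (volume : Measure (Fin n → ℂ)) hL0
  have hquad : ∀ u : Fin n → ℂ, (u ⬝ᵥ A *ᵥ star u).re = ∑ i, ‖L u i‖ ^ 2 := by
    intro u
    have h1 : L u = star (N *ᵥ star u) := by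
      rw [star_mulVec]
      simp [L, mulVec_transpose]
    rw [h1, hN, ← mulVec_mulVec, star_eq_conjTranspose, dotProduct_mulVec]
    have h2 : u ᵥ* Nᴴ = star (N *ᵥ star u) := by rw [star_mulVec, star_star]
    rw [h2]
    simp only [dotProduct, Complex.re_sum]
    refine Finset.sum_congr rfl fun i _ => ?_
    simp [← Complex.normSq_eq_norm_sq, Complex.normSq_apply]
  have hm : Measurable L := (LinearMap.continuous_of_finiteDimensional L).measurable
  have key : ∫⁻ u : Fin n → ℂ, ENNReal.ofReal (Real.exp (-(u ⬝ᵥ A *ᵥ star u).re)) =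
      ∫⁻ w, ENNReal.ofReal (Real.exp (-∑ i, ‖w i‖ ^ 2)) ∂(Measure.map L volume) := by
    rw [lintegral_map _ hm]
    · simp_rw [hquad]
    · fun_prop
  rw [key, hmap, lintegral_smul_measure, lintegral_exp_neg_sum_norm_sq, hLdet, smul_eq_mul,
    ← ENNReal.ofReal_mul (abs_nonneg _), abs_of_pos (inv_pos.mpr hdpos)]
  congr 1
  field_simp

theorem lintegral_exp_neg_quadratic_add_linear {n : ℕ} {A : Matrix (Fin n) (Fin n) ℂ}
    (hA : A.PosDef) (c : Fin n → ℂ) {y : ℝ} (hy : 0 < y) :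
    ∫⁻ u : Fin n → ℂ, ENNReal.ofReal
        (Real.exp (-((u ⬝ᵥ A *ᵥ star u).re / y + 2 * (c ⬝ᵥ star u).re))) =
      ENNReal.ofReal
        (Real.pi ^ n * y ^ n / A.det.re * Real.exp (y * (c ⬝ᵥ A⁻¹ *ᵥ star c).re)) := by
  have hu : IsUnit A.det := (isUnit_iff_isUnit_det A).mp hA.isUnit
  have hdpos : 0 < A.det.re := (Complex.pos_iff.mp hA.det_pos).1
  have hA' : (((y⁻¹ : ℝ) : ℂ) • A).PosDef := hA.smul (by simpa using hy)
  set s : Fin n → ℂ := (y : ℂ) • (c ᵥ* A⁻¹) with hs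
  have hstar : star s = (y : ℂ) • (A⁻¹ *ᵥ star c) := by
    rw [hs, star_smul, star_vecMul, hA.inv.1]
    simp
  have hexp : ∀ u : Fin n → ℂ, ((u - s) ⬝ᵥ A *ᵥ star (u - s)).re / y
        + 2 * (c ⬝ᵥ star (u - s)).re =
      (u ⬝ᵥ (((y⁻¹ : ℝ) : ℂ) • A) *ᵥ star u).re - y * (c ⬝ᵥ A⁻¹ *ᵥ star c).re := by
    intro u
    have e1 : A *ᵥ star s = (y : ℂ) • star c := by
      rw [hstar, mulVec_smul, mulVec_mulVec, mul_nonsing_inv _ hu, one_mulVec]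
    have e2 : s ᵥ* A = (y : ℂ) • c := by
      rw [hs, smul_vecMul, vecMul_vecMul, nonsing_inv_mul _ hu, vecMul_one]
    have e3 : (u ⬝ᵥ star c).re = (c ⬝ᵥ star u).re := by
      simp only [dotProduct, Complex.re_sum]
      refine Finset.sum_congr rfl fun i _ => ?_
      simp; ring
    have e4 : (c ⬝ᵥ star s).re = y * (c ⬝ᵥ A⁻¹ *ᵥ star c).re := by
      rw [hstar, dotProduct_smul]; simp
    have e5 : s ⬝ᵥ A *ᵥ star u = (y : ℂ) * (c ⬝ᵥ star u) := by
      rw [dotProduct_mulVec, e2, smul_dotProduct, smul_eq_mul]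
    have e6 : s ⬝ᵥ star c = c ⬝ᵥ star s := by
      rw [hstar, hs, dotProduct_smul, smul_dotProduct, dotProduct_mulVec]
    rw [star_sub, mulVec_sub, dotProduct_sub, sub_dotProduct, sub_dotProduct, dotProduct_sub, e1,
      e5, smul_mulVec, dotProduct_smul, dotProduct_smul, dotProduct_smul, e6]
    simp only [smul_eq_mul, Complex.sub_re, Complex.re_ofReal_mul, e3, e4]
    field_simp
    ring
  rw [← lintegral_sub_right_eq_self _ s]
  simp_rw [hexp, neg_sub, sub_eq_add_neg, Real.exp_add,
    ENNReal.ofReal_mul (Real.exp_pos _).le]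
  rw [lintegral_const_mul' _ _ ENNReal.ofReal_ne_top, lintegral_exp_neg_quadratic hA',
    ← ENNReal.ofReal_mul (Real.exp_pos _).le]
  congr 1
  rw [det_smul, ← Complex.ofReal_pow, Complex.re_ofReal_mul]
  simp only [Fintype.card_fin]
  rw [inv_pow]
  field_simp

/-- Splitting the strictly upper-triangular positions of size `n + 1` into the first row
and the positions of size `n`. -/
noncomputable def upperSuccEquiv (n : ℕ) :
    Fin n ⊕ { q : Fin n × Fin n // q.1 < q.2 } ≃
      { q : Fin (n + 1) × Fin (n + 1) // q.1 < q.2 } :=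
  Equiv.ofBijective
    (Sum.elim (fun j => ⟨(0, j.succ), Fin.succ_pos j⟩)
      (fun q => ⟨(q.1.1.succ, q.1.2.succ), Fin.succ_lt_succ_iff.mpr q.2⟩)) <| by
    constructor
    · rintro (i | ⟨⟨a, b⟩, h⟩) (j | ⟨⟨c, d⟩, h'⟩) hij <;> simp_all [Fin.succ_ne_zero]
      exact absurd hij.1.symm (Fin.succ_ne_zero _)
    · rintro ⟨⟨a, b⟩, h⟩
      induction b using Fin.cases with
      | zero => exact absurd h (Fin.not_lt_zero a)
      | succ b =>
        induction a using Fin.cases with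
        | zero => exact ⟨Sum.inl b, rfl⟩
        | succ a => exact ⟨Sum.inr ⟨(a, b), Fin.succ_lt_succ_iff.mp h⟩, rfl⟩

/-- Adjoin a first row, with diagonal entry `y` and off-diagonal entries `u`. -/
noncomputable def HermParam.cons {n : ℕ} (y : ℝ) (u : Fin n → ℂ) (T : HermParam n) :
    HermParam (n + 1) :=
  (Fin.cons y T.1, fun q => Sum.elim u T.2 ((upperSuccEquiv n).symm q))

theorem measurable_hermParam_cons (n : ℕ) :
    Measurable fun r : ℝ × (Fin n → ℂ) × HermParam n => HermParam.cons r.1 r.2.1 r.2.2 := by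
  refine Measurable.prodMk ?_ ?_
  · refine measurable_pi_lambda _ fun i => ?_
    induction i using Fin.cases <;> simp <;> fun_prop
  · refine measurable_pi_lambda _ fun q => ?_
    rcases (upperSuccEquiv n).symm q with j | j <;> simp <;> fun_prop

theorem lintegral_hermParam_succ {n : ℕ} {G : HermParam (n + 1) → ENNReal} (hG : Measurable G) :
    ∫⁻ T, G T = ∫⁻ y : ℝ, ∫⁻ u : Fin n → ℂ, ∫⁻ T : HermParam n, G (HermParam.cons y u T) := by
  have hz : ∀ d : Fin (n + 1) → ℝ, ∫⁻ z, G (d, z) =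
      ∫⁻ u : Fin n → ℂ, ∫⁻ t : { q : Fin n × Fin n // q.1 < q.2 } → ℂ,
        G (d, fun q => Sum.elim u t ((upperSuccEquiv n).symm q)) := by
    intro d
    have h1 := volume_measurePreserving_piCongrLeft
      (fun _ : { q : Fin (n + 1) × Fin (n + 1) // q.1 < q.2 } => ℂ) (upperSuccEquiv n)
    have h2 := volume_measurePreserving_sumPiEquivProdPi_symm
      (fun _ : Fin n ⊕ { q : Fin n × Fin n // q.1 < q.2 } => ℂ)
    have hGd : Measurable fun z => G (d, z) := by fun_prop
    rw [← (h1.comp h2).lintegral_comp hGd, Measure.volume_eq_prod, lintegral_prod]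
    · refine lintegral_congr fun u => lintegral_congr fun t => ?_
      congr 2
      funext q
      obtain ⟨x, rfl⟩ := (upperSuccEquiv n).surjective q
      simp only [Function.comp_apply, MeasurableEquiv.coe_piCongrLeft,
        Equiv.piCongrLeft_apply_apply, Equiv.symm_apply_apply]
      cases x <;> rfl
    · exact (hGd.comp (h1.comp h2).measurable).aemeasurable
  have hd := (volume_preserving_piFinSuccAbove (fun _ : Fin (n + 1) => ℝ) 0).symm
  have hcons : ∀ r : ℝ × (Fin n → ℝ),
      (MeasurableEquiv.piFinSuccAbove (fun _ : Fin (n + 1) => ℝ) 0).symm r =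
        Fin.cons r.1 r.2 := by
    intro r
    funext i
    induction i using Fin.cases <;> simp [MeasurableEquiv.piFinSuccAbove]
  have hm := hG.comp (measurable_hermParam_cons n)
  simp only [Function.comp_def, HermParam.cons] at hm
  rw [Measure.volume_eq_prod, lintegral_prod _ hG.aemeasurable]
  simp_rw [hz]
  rw [← hd.lintegral_comp_emb (MeasurableEquiv.measurableEmbedding _)]
  simp_rw [hcons]
  rw [Measure.volume_eq_prod, lintegral_prod]
  · refine lintegral_congr fun y => ?_
    rw [lintegral_lintegral_swap]
    · refine lintegral_congr fun u => ?_
      rw [Measure.volume_eq_prod (Fin n → ℝ), lintegral_prod]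
      · rfl
      · exact Measurable.aemeasurable (hm.comp
          (f := fun r : (Fin n → ℝ) × ({ q : Fin n × Fin n // q.1 < q.2 } → ℂ) =>
            (y, u, r)) (by fun_prop))
    · refine Measurable.aemeasurable ?_
      simp only [Function.uncurry_def]
      refine Measurable.lintegral_prod_right' (f := fun r :
        ((Fin n → ℝ) × (Fin n → ℂ)) × ({ q : Fin n × Fin n // q.1 < q.2 } → ℂ) =>
          G (Fin.cons y r.1.1, fun q => Sum.elim r.1.2 r.2 ((upperSuccEquiv n).symm q))) ?_
      exact hm.comp (f := fun r :
        ((Fin n → ℝ) × (Fin n → ℂ)) × ({ q : Fin n × Fin n // q.1 < q.2 } → ℂ) =>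
          (y, r.1.2, r.1.1, r.2)) (by fun_prop)
  · refine Measurable.aemeasurable ?_
    refine Measurable.lintegral_prod_right' (f := fun r :
      (ℝ × (Fin n → ℝ)) × (Fin n → ℂ) =>
        ∫⁻ t, G (Fin.cons r.1.1 r.1.2, fun q => Sum.elim r.2 t ((upperSuccEquiv n).symm q))) ?_
    refine Measurable.lintegral_prod_right' (f := fun r :
      ((ℝ × (Fin n → ℝ)) × (Fin n → ℂ)) × ({ q : Fin n × Fin n // q.1 < q.2 } → ℂ) =>
        G (Fin.cons r.1.1.1 r.1.1.2,
          fun q => Sum.elim r.1.2 r.2 ((upperSuccEquiv n).symm q))) ?_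
    exact hm.comp (f := fun r :
      ((ℝ × (Fin n → ℝ)) × (Fin n → ℂ)) × ({ q : Fin n × Fin n // q.1 < q.2 } → ℂ) =>
        (r.1.1.1, r.1.2, r.1.1.2, r.2)) (by fun_prop)

theorem toHermMatrix_add {n : ℕ} (S T : HermParam n) :
    toHermMatrix n (S + T) = toHermMatrix n S + toHermMatrix n T := by
  ext i j
  rcases lt_trichotomy i j with h | h | h
  · simp [toHermMatrix, h]
  · simp [toHermMatrix, h]
  · simp [toHermMatrix, h, h.not_gt]

theorem exists_toHermMatrix_eq {n : ℕ} {H : Matrix (Fin n) (Fin n) ℂ} (hH : H.IsHermitian) :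
    ∃ T, toHermMatrix n T = H := by
  refine ⟨(fun i => (H i i).re, fun q => H q.1.1 q.1.2), ?_⟩
  ext i j
  rcases lt_trichotomy i j with h | h | h
  · simp [toHermMatrix, h]
  · subst h
    simpa [toHermMatrix] using Complex.conj_eq_iff_re.mp (hH.apply i i)
  · simpa [toHermMatrix, h, h.not_gt] using hH.apply i j

theorem toHermMatrix_injective (n : ℕ) : Function.Injective (toHermMatrix n) := by
  intro S T h
  refine Prod.ext (funext fun i => ?_) (funext fun q => ?_)
  · simpa [toHermMatrix] using congrFun (congrFun h i) i
  · simpa [toHermMatrix, q.2] using congrFun (congrFun h q.1.1) q.1.2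

theorem continuous_toHermMatrix (n : ℕ) : Continuous (toHermMatrix n) := by
  refine continuous_matrix fun i j => ?_
  rcases lt_trichotomy i j with h | h | h
  · simp only [toHermMatrix, h, of_apply, dif_pos]; fun_prop
  · simp only [toHermMatrix, h, of_apply, lt_irrefl, dif_neg, not_false_eq_true]; fun_prop
  · simp only [toHermMatrix, h, h.not_gt, of_apply, dif_pos, dif_neg, not_false_eq_true]
    fun_prop

instance borelSpace_complexMatrix (m n : ℕ) : BorelSpace (Matrix (Fin m) (Fin n) ℂ) :=
  inferInstanceAs (BorelSpace (Fin m → Fin n → ℂ))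

theorem measurableEmbedding_toHermMatrix (n : ℕ) : MeasurableEmbedding (toHermMatrix n) :=
  (continuous_toHermMatrix n).measurableEmbedding (toHermMatrix_injective n)

instance sigmaFinite_hermLebesgue (n : ℕ) : SigmaFinite (hermLebesgue n) :=
  (measurableEmbedding_toHermMatrix n).sigmaFinite_map

theorem measurableSet_posDef (n : ℕ) :
    MeasurableSet {X : Matrix (Fin n) (Fin n) ℂ | X.PosDef} := by
  have h : {X : Matrix (Fin n) (Fin n) ℂ | X.PosDef} =
      ({X | Xᴴ = X} ∩ ⋂ x : Fin n → ℂ, {X | 0 ≤ star x ⬝ᵥ (X *ᵥ x)}) ∩ {X | X.det = 0}ᶜ := by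
    ext X
    simp only [Set.mem_ofPred_eq, Set.mem_inter_iff, Set.mem_iInter, Set.mem_compl_iff]
    constructor
    · intro hX
      exact ⟨⟨hX.1, hX.posSemidef.dotProduct_mulVec_nonneg⟩, hX.det_pos.ne'⟩
    · rintro ⟨⟨h1, h2⟩, h3⟩
      exact (PosSemidef.of_dotProduct_mulVec_nonneg h1 h2).posDef_iff_det_ne_zero.mpr h3
  rw [h]
  refine ((IsClosed.inter ?_ (isClosed_iInter fun x => ?_)).measurableSet).inter
    (IsClosed.measurableSet ?_).compl
  · exact isClosed_eq (by fun_prop) continuous_id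
  · exact isClosed_le continuous_const (by fun_prop)
  · exact isClosed_eq (by fun_prop) continuous_const

/-- The matrix with first diagonal entry `y`, remaining first row `u`, first column determined by
self-adjointness, and lower right block `Z`. -/
def borderedMatrix {n : ℕ} (y : ℝ) (u : Fin n → ℂ) (Z : Matrix (Fin n) (Fin n) ℂ) :
    Matrix (Unit ⊕ Fin n) (Unit ⊕ Fin n) ℂ :=
  fromBlocks (of fun _ _ => (y : ℂ)) (replicateRow Unit u) (replicateRow Unit u)ᴴ Z

/-- Splitting off the first index. -/
def finSuccEquivUnitSum (n : ℕ) : Fin (n + 1) ≃ Unit ⊕ Fin n where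
  toFun := Fin.cons (Sum.inl ()) Sum.inr
  invFun := Sum.elim (fun _ => 0) Fin.succ
  left_inv i := by induction i using Fin.cases <;> simp
  right_inv i := by rcases i with i | i <;> simp

@[simp] theorem finSuccEquivUnitSum_zero (n : ℕ) :
    finSuccEquivUnitSum n 0 = Sum.inl () := rfl

@[simp] theorem finSuccEquivUnitSum_succ {n : ℕ} (i : Fin n) :
    finSuccEquivUnitSum n i.succ = Sum.inr i := rfl

theorem toHermMatrix_cons {n : ℕ} (y : ℝ) (u : Fin n → ℂ) (T : HermParam n) :
    toHermMatrix (n + 1) (HermParam.cons y u T) =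
      (borderedMatrix y u (toHermMatrix n T)).submatrix
        (finSuccEquivUnitSum n) (finSuccEquivUnitSum n) := by
  have hl : ∀ j : Fin n, (upperSuccEquiv n).symm ⟨(0, j.succ), Fin.succ_pos j⟩ = Sum.inl j :=
    fun j => (Equiv.symm_apply_eq _).mpr rfl
  have hr : ∀ (a b : Fin n) (h : a < b),
      (upperSuccEquiv n).symm ⟨(a.succ, b.succ), Fin.succ_lt_succ_iff.mpr h⟩ =
        Sum.inr ⟨(a, b), h⟩ :=
    fun a b h => (Equiv.symm_apply_eq _).mpr rfl
  ext i j
  induction i using Fin.cases with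
  | zero =>
    induction j using Fin.cases with
    | zero => simp [toHermMatrix, HermParam.cons, borderedMatrix]
    | succ j => simp [toHermMatrix, HermParam.cons, borderedMatrix, hl]
  | succ i =>
    induction j using Fin.cases with
    | zero => simp [toHermMatrix, HermParam.cons, borderedMatrix, hl]
    | succ j =>
      rcases lt_trichotomy i j with h | h | h
      · simp [toHermMatrix, HermParam.cons, borderedMatrix, h, hr i j h]
      · simp [toHermMatrix, HermParam.cons, borderedMatrix, h]
      · simp [toHermMatrix, HermParam.cons, borderedMatrix, h, h.not_gt, hr j i h]

theorem posDef_submatrix_equiv_iff {m n : Type*} [Fintype m] [Fintype n]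
    {M : Matrix n n ℂ} (e : m ≃ n) : (M.submatrix e e).PosDef ↔ M.PosDef := by
  refine ⟨fun h => ?_, fun h => h.submatrix e.injective⟩
  simpa using h.submatrix e.symm.injective

theorem borderedMatrix_pos {n : ℕ} {y : ℝ} {u : Fin n → ℂ} {Z : Matrix (Fin n) (Fin n) ℂ}
    (h : (borderedMatrix y u Z).PosDef) : 0 < y := by
  have := h.diag_pos (i := Sum.inl ())
  simpa [borderedMatrix] using this

theorem borderedMatrix_posDef_right {n : ℕ} {y : ℝ} {u : Fin n → ℂ}
    {Z : Matrix (Fin n) (Fin n) ℂ} (h : (borderedMatrix y u Z).PosDef) : Z.PosDef := by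
  have := h.submatrix (e := Sum.inr) Sum.inr_injective
  exact this

/-- The rank one Hermitian matrix `y⁻¹ u* u`. -/
noncomputable def schurShift {n : ℕ} (y : ℝ) (u : Fin n → ℂ) : Matrix (Fin n) (Fin n) ℂ :=
  of fun i j => (y : ℂ)⁻¹ * (star (u i) * u j)

theorem schurShift_isHermitian {n : ℕ} (y : ℝ) (u : Fin n → ℂ) :
    (schurShift y u).IsHermitian := by
  ext i j
  simp [schurShift, mul_comm]

theorem schur_complement_aux {n : ℕ} {y : ℝ} (hy : 0 < y) (u : Fin n → ℂ) :
    IsUnit (of fun _ _ => (y : ℂ) : Matrix Unit Unit ℂ) ∧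
    (of fun _ _ => (y : ℂ) : Matrix Unit Unit ℂ).PosDef ∧
    (of fun _ _ => (y : ℂ) : Matrix Unit Unit ℂ).det = y ∧
    (replicateRow Unit u)ᴴ * (of fun _ _ => (y : ℂ) : Matrix Unit Unit ℂ)⁻¹ * replicateRow Unit u =
      schurShift y u := by
  have hyc : (y : ℂ) ≠ 0 := by exact_mod_cast hy.ne'
  have hdet : (of fun _ _ => (y : ℂ) : Matrix Unit Unit ℂ).det = y := by simp [det_unique]
  have hu : IsUnit (of fun _ _ => (y : ℂ) : Matrix Unit Unit ℂ) := by
    rw [isUnit_iff_isUnit_det, hdet]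
    exact isUnit_iff_ne_zero.mpr hyc
  have hp : (of fun _ _ => (y : ℂ) : Matrix Unit Unit ℂ).PosDef := by
    have : (of fun _ _ => (y : ℂ) : Matrix Unit Unit ℂ) = diagonal fun _ => (y : ℂ) := by
      ext i j; simp
    rw [this]
    exact PosDef.diagonal fun _ => by exact_mod_cast hy
  have hinv : (of fun _ _ => (y : ℂ) : Matrix Unit Unit ℂ)⁻¹ = of fun _ _ => (y : ℂ)⁻¹ := by
    refine inv_eq_left_inv ?_
    ext i j
    simp [mul_apply, hyc]
  refine ⟨hu, hp, hdet, ?_⟩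
  rw [hinv]
  ext i j
  simp [schurShift, mul_apply]
  ring

theorem det_borderedMatrix_add {n : ℕ} {y : ℝ} (hy : 0 < y) (u : Fin n → ℂ)
    (W : Matrix (Fin n) (Fin n) ℂ) :
    (borderedMatrix y u (W + schurShift y u)).det = y * W.det := by
  obtain ⟨hu, hp, hdet, hs⟩ := schur_complement_aux hy u
  let _ := hu.invertible
  rw [borderedMatrix, det_fromBlocks₁₁, hdet, invOf_eq_nonsing_inv, hs, add_sub_cancel_right]

theorem posDef_borderedMatrix_add_iff {n : ℕ} {y : ℝ} (hy : 0 < y) (u : Fin n → ℂ)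
    (W : Matrix (Fin n) (Fin n) ℂ) :
    (borderedMatrix y u (W + schurShift y u)).PosDef ↔ W.PosDef := by
  obtain ⟨hu, hp, hdet, hs⟩ := schur_complement_aux hy u
  let _ := hu.invertible
  have hyc : (y : ℂ) ≠ 0 := by exact_mod_cast hy.ne'
  have hd := det_borderedMatrix_add hy u W
  have key : (borderedMatrix y u (W + schurShift y u)).PosSemidef ↔ W.PosSemidef := by
    rw [borderedMatrix, PosDef.fromBlocks₁₁ _ _ hp, hs, add_sub_cancel_right]
  constructor
  · intro h
    refine (key.mp h.posSemidef).posDef_iff_det_ne_zero.mpr fun h0 => h.det_pos.ne' ?_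
    rw [hd, h0, mul_zero]
  · intro h
    refine (key.mpr h.posSemidef).posDef_iff_det_ne_zero.mpr ?_
    rw [hd]
    exact mul_ne_zero hyc h.det_pos.ne'

theorem trace_borderedMatrix_mul {n : ℕ} (b y : ℝ) (c u : Fin n → ℂ)
    (D W : Matrix (Fin n) (Fin n) ℂ) :
    (trace (borderedMatrix b c D * borderedMatrix y u (W + schurShift y u))).re =
      b * y + ((u ⬝ᵥ D *ᵥ star u).re / y + 2 * (c ⬝ᵥ star u).re) + (trace (D * W)).re := by
  have h1 : (trace (D * schurShift y u)).re = (u ⬝ᵥ D *ᵥ star u).re / y := by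
    have : trace (D * schurShift y u) = ((y⁻¹ : ℝ) : ℂ) * (u ⬝ᵥ D *ᵥ star u) := by
      simp only [trace, diag_apply, mul_apply, schurShift, dotProduct, mulVec, of_apply,
        Finset.mul_sum, Pi.star_apply]
      refine Finset.sum_congr rfl fun i _ => Finset.sum_congr rfl fun j _ => ?_
      push_cast
      ring
    rw [this, Complex.re_ofReal_mul]
    ring
  have h2 : trace (replicateRow Unit c * (replicateRow Unit u)ᴴ) = c ⬝ᵥ star u := by
    simp [trace, mul_apply, dotProduct]
  have h3 : (trace ((replicateRow Unit c)ᴴ * replicateRow Unit u)).re = (c ⬝ᵥ star u).re := by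
    simp only [trace, diag_apply, mul_apply, dotProduct, Complex.re_sum]
    refine Finset.sum_congr rfl fun i _ => ?_
    simp
  have h4 : (trace ((of fun _ _ => (b : ℂ) : Matrix Unit Unit ℂ) * of fun _ _ => (y : ℂ))).re =
      b * y := by
    simp [trace, mul_apply]
  have htr : ∀ (P : Matrix Unit Unit ℂ) (Q : Matrix Unit (Fin n) ℂ) (R : Matrix (Fin n) Unit ℂ)
      (S : Matrix (Fin n) (Fin n) ℂ), trace (fromBlocks P Q R S) = trace P + trace S := by
    intro P Q R S
    simp [trace]
  rw [borderedMatrix, borderedMatrix, fromBlocks_multiply, htr, trace_add, trace_add, h2, mul_add,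
    trace_add]
  simp only [Complex.add_re, h1, h3, h4]
  ring

theorem exists_eq_borderedMatrix {n : ℕ} {B : Matrix (Fin (n + 1)) (Fin (n + 1)) ℂ}
    (hB : B.IsHermitian) : ∃ (b : ℝ) (c : Fin n → ℂ) (D : Matrix (Fin n) (Fin n) ℂ),
      B = (borderedMatrix b c D).submatrix (finSuccEquivUnitSum n) (finSuccEquivUnitSum n) := by
  refine ⟨(B 0 0).re, fun j => B 0 j.succ, of fun i j => B i.succ j.succ, ?_⟩
  ext i j
  induction i using Fin.cases with
  | zero =>
    induction j using Fin.cases with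
    | zero => simpa [borderedMatrix] using (Complex.conj_eq_iff_re.mp (hB.apply 0 0)).symm
    | succ j => simp [borderedMatrix]
  | succ i =>
    induction j using Fin.cases with
    | zero => simpa [borderedMatrix] using (hB.apply i.succ 0).symm
    | succ j => simp [borderedMatrix]

theorem Matrix.PosDef.det_re_pos {n : ℕ} {B : Matrix (Fin n) (Fin n) ℂ} (hB : B.PosDef) :
    0 < B.det.re := (Complex.pos_iff.mp hB.det_pos).1

theorem Matrix.PosDef.ofReal_det_re {n : ℕ} {B : Matrix (Fin n) (Fin n) ℂ} (hB : B.PosDef) :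
    (B.det.re : ℂ) = B.det :=
  Complex.ext rfl (Complex.pos_iff.mp hB.det_pos).2

theorem det_re_borderedMatrix {n : ℕ} {b : ℝ} {c : Fin n → ℂ} {D : Matrix (Fin n) (Fin n) ℂ}
    (hD : D.PosDef) :
    (borderedMatrix b c D).det.re = D.det.re * (b - (c ⬝ᵥ D⁻¹ *ᵥ star c).re) := by
  let _ := hD.isUnit.invertible
  rw [borderedMatrix, det_fromBlocks₂₂, invOf_eq_nonsing_inv, ← hD.ofReal_det_re,
    Complex.re_ofReal_mul, det_unique (n := Unit)]
  congr 1
  rw [Matrix.sub_apply, Complex.sub_re, of_apply, Complex.ofReal_re]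
  congr 2
  rw [Matrix.mul_assoc]
  simp [mul_apply, dotProduct, mulVec]

/-- The measure `y ^ n e^{-y} dy` on the positive half-line. -/
noncomputable def gammaMeasureNat (n : ℕ) : Measure ℝ :=
  (volume.restrict (Set.Ioi 0)).withDensity fun y => ENNReal.ofReal (y ^ n * Real.exp (-y))

instance sFinite_gammaMeasureNat (n : ℕ) : SFinite (gammaMeasureNat n) := by
  unfold gammaMeasureNat; infer_instance

/-- The multiplicative convolution of the measures `y ^ j e^{-y} dy`, `j < n`. -/
noncomputable def detLaw : ℕ → Measure ℝ
  | 0 => Measure.dirac 1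
  | n + 1 => ((gammaMeasureNat n).prod (detLaw n)).map fun q => q.1 * q.2

instance sFinite_detLaw (n : ℕ) : SFinite (detLaw n) := by
  induction n with
  | zero => unfold detLaw; infer_instance
  | succ n ih => unfold detLaw; infer_instance

theorem lintegral_detLaw_succ (n : ℕ) {F : ℝ → ENNReal} (hF : Measurable F) :
    ∫⁻ t, F t ∂(detLaw (n + 1)) = ∫⁻ y in Set.Ioi 0,
      ENNReal.ofReal (y ^ n * Real.exp (-y)) * ∫⁻ t, F (y * t) ∂(detLaw n) := by
  have hFm : Measurable fun q : ℝ × ℝ => F (q.1 * q.2) := by fun_prop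
  rw [detLaw, lintegral_map hF (by fun_prop), lintegral_prod _ hFm.aemeasurable, gammaMeasureNat,
    lintegral_withDensity_eq_lintegral_mul _ (by fun_prop) hFm.lintegral_prod_right']
  rfl

theorem lintegral_Ioi_comp_mul_left {s : ℝ} (hs : 0 < s) {H : ℝ → ENNReal} (hH : Measurable H) :
    ∫⁻ x in Set.Ioi 0, H x = ENNReal.ofReal s * ∫⁻ y in Set.Ioi 0, H (s * y) := by
  have h := Real.smul_map_volume_mul_left hs.ne'
  have hi : Measurable ((Set.Ioi (0 : ℝ)).indicator H) := hH.indicator measurableSet_Ioi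
  rw [← lintegral_indicator measurableSet_Ioi, ← lintegral_indicator measurableSet_Ioi]
  conv_lhs => rw [← h]
  rw [lintegral_smul_measure, lintegral_map hi (by fun_prop), abs_of_pos hs, smul_eq_mul]
  congr 1
  refine lintegral_congr fun y => ?_
  by_cases hy : 0 < y
  · have : 0 < s * y := mul_pos hs hy
    simp [Set.indicator, hy, this]
  · have : ¬ 0 < s * y := fun h' => hy (pos_of_mul_pos_right h' hs.le)
    simp [Set.indicator, hy, this]

/-- The function `F (det X) e^{-tr (B X)}` on positive definite matrices, extended by zero. -/
noncomputable def detExpTrace {n : ℕ} (F : ℝ → ENNReal) (B X : Matrix (Fin n) (Fin n) ℂ) :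
    ENNReal :=
  {X : Matrix (Fin n) (Fin n) ℂ | X.PosDef}.indicator
    (fun X => F X.det.re * ENNReal.ofReal (Real.exp (-(trace (B * X)).re))) X

theorem measurable_det_re (n : ℕ) :
    Measurable fun X : Matrix (Fin n) (Fin n) ℂ => X.det.re :=
  Continuous.measurable (by fun_prop)

theorem measurable_exp_neg_trace_re {n : ℕ} (B : Matrix (Fin n) (Fin n) ℂ) :
    Measurable fun X : Matrix (Fin n) (Fin n) ℂ =>
      ENNReal.ofReal (Real.exp (-(trace (B * X)).re)) :=
  ENNReal.measurable_ofReal.comp (Continuous.measurable (by fun_prop))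

theorem measurable_detExpTrace {n : ℕ} {F : ℝ → ENNReal} (hF : Measurable F)
    (B : Matrix (Fin n) (Fin n) ℂ) : Measurable (detExpTrace F B) :=
  ((hF.comp (measurable_det_re n)).mul (measurable_exp_neg_trace_re B)).indicator
    (measurableSet_posDef n)

theorem detExpTrace_cons_of_nonpos {n : ℕ} (F : ℝ → ENNReal)
    (B : Matrix (Fin (n + 1)) (Fin (n + 1)) ℂ) {y : ℝ} (hy : y ≤ 0) (u : Fin n → ℂ)
    (T : HermParam n) :
    detExpTrace F B (toHermMatrix (n + 1) (HermParam.cons y u T)) = 0 := by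
  refine Set.indicator_of_notMem (fun h => ?_) _
  rw [Set.mem_ofPred_eq, toHermMatrix_cons, posDef_submatrix_equiv_iff] at h
  exact (borderedMatrix_pos h).not_ge hy

theorem lintegral_detExpTrace_cons {n : ℕ} {F : ℝ → ENNReal} (hF : Measurable F)
    (b : ℝ) (c : Fin n → ℂ) (D : Matrix (Fin n) (Fin n) ℂ) {y : ℝ} (hy : 0 < y)
    (u : Fin n → ℂ) :
    ∫⁻ T, detExpTrace F
        ((borderedMatrix b c D).submatrix (finSuccEquivUnitSum n) (finSuccEquivUnitSum n))
        (toHermMatrix (n + 1) (HermParam.cons y u T)) =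
      ENNReal.ofReal (Real.exp (-(b * y))) *
      ENNReal.ofReal (Real.exp (-((u ⬝ᵥ D *ᵥ star u).re / y + 2 * (c ⬝ᵥ star u).re))) *
        ∫⁻ T, detExpTrace (fun t => F (y * t)) D (toHermMatrix n T) := by
  obtain ⟨S, hS⟩ := exists_toHermMatrix_eq (schurShift_isHermitian y u)
  have hm : Measurable fun T => detExpTrace (fun t => F (y * t)) D (toHermMatrix n T) :=
    (measurable_detExpTrace (by fun_prop) D).comp (continuous_toHermMatrix n).measurable
  have : (volume : Measure (HermParam n)).IsAddLeftInvariant := by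
    exact Measure.prod.instIsAddLeftInvariant
  rw [← lintegral_const_mul _ hm, ← lintegral_add_left_eq_self _ S]
  refine lintegral_congr fun T => ?_
  rw [add_comm S T, toHermMatrix_cons, toHermMatrix_add, hS]
  by_cases hT : (toHermMatrix n T).PosDef
  · rw [detExpTrace, detExpTrace, Set.indicator_of_mem, Set.indicator_of_mem]
    · rw [det_submatrix_equiv_self, det_borderedMatrix_add hy, Complex.re_ofReal_mul,
        submatrix_mul_equiv]
      have htr : ∀ M : Matrix (Unit ⊕ Fin n) (Unit ⊕ Fin n) ℂ,
          trace (M.submatrix (finSuccEquivUnitSum n) (finSuccEquivUnitSum n)) = trace M :=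
        fun M => Equiv.sum_comp (finSuccEquivUnitSum n) fun i => M i i
      rw [htr, trace_borderedMatrix_mul, neg_add, neg_add, Real.exp_add, Real.exp_add,
        ENNReal.ofReal_mul (by positivity), ENNReal.ofReal_mul (by positivity)]
      ring_nf
    · exact hT
    · exact (posDef_submatrix_equiv_iff _).mpr ((posDef_borderedMatrix_add_iff hy u _).mpr hT)
  · rw [detExpTrace, detExpTrace, Set.indicator_of_notMem, Set.indicator_of_notMem, mul_zero]
    · exact hT
    · rw [Set.mem_ofPred_eq, posDef_submatrix_equiv_iff, posDef_borderedMatrix_add_iff hy u]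
      exact hT

theorem lintegral_detExpTrace {n : ℕ} {F : ℝ → ENNReal} (hF : Measurable F)
    {B : Matrix (Fin n) (Fin n) ℂ} (hB : B.PosDef) :
    ∫⁻ T, detExpTrace F B (toHermMatrix n T) =
      ENNReal.ofReal (Real.pi ^ (n * (n - 1) / 2) / B.det.re ^ n) *
        ∫⁻ t, F (t / B.det.re) ∂(detLaw n) := by
  induction n generalizing F with
  | zero =>
    have h1 : ∀ X : Matrix (Fin 0) (Fin 0) ℂ, detExpTrace F B X = F 1 := by
      intro X
      have : X ∈ {X : Matrix (Fin 0) (Fin 0) ℂ | X.PosDef} := Subsingleton.elim B X ▸ hB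
      rw [detExpTrace, Set.indicator_of_mem this]
      simp
    simp_rw [h1]
    rw [lintegral_const, Measure.volume_eq_prod, Measure.prod_apply MeasurableSet.univ]
    simp [detLaw, volume_pi]
  | succ n ih =>
    obtain ⟨b, c, D, hBe⟩ := exists_eq_borderedMatrix hB.1
    subst hBe
    have hB' := (posDef_submatrix_equiv_iff _).mp hB
    have hD := borderedMatrix_posDef_right hB'
    have hd := hD.det_re_pos
    set d := D.det.re with hd_def
    set q := (c ⬝ᵥ D⁻¹ *ᵥ star c).re with hq_def
    have hdet : ((borderedMatrix b c D).submatrix (finSuccEquivUnitSum n)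
        (finSuccEquivUnitSum n)).det.re = d * (b - q) := by
      rw [det_submatrix_equiv_self, det_re_borderedMatrix hD]
    have hs : 0 < b - q := by
      have := hB.det_re_pos
      rw [hdet] at this
      exact pos_of_mul_pos_right this hd.le
    set s := b - q with hs_def
    have hI : Measurable fun y : ℝ => ∫⁻ t, F (y * t / d) ∂(detLaw n) :=
      Measurable.lintegral_prod_right' (f := fun r : ℝ × ℝ => F (r.1 * r.2 / d)) (by fun_prop)
    have hinner : ∀ y : ℝ, ∫⁻ u : Fin n → ℂ, ∫⁻ T, detExpTrace F
        ((borderedMatrix b c D).submatrix (finSuccEquivUnitSum n) (finSuccEquivUnitSum n))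
        (toHermMatrix (n + 1) (HermParam.cons y u T)) =
        (Set.Ioi (0 : ℝ)).indicator (fun y =>
          ENNReal.ofReal (Real.pi ^ ((n + 1) * (n + 1 - 1) / 2) / d ^ (n + 1)) *
            (ENNReal.ofReal (y ^ n * Real.exp (-(s * y))) *
              ∫⁻ t, F (y * t / d) ∂(detLaw n))) y := by
      intro y
      rcases le_or_gt y 0 with hy | hy
      · rw [Set.indicator_of_notMem (by simpa using hy)]
        simp_rw [detExpTrace_cons_of_nonpos F _ hy]
        simp
      · rw [Set.indicator_of_mem (by simpa using hy)]
        simp_rw [lintegral_detExpTrace_cons hF b c D hy]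
        rw [lintegral_mul_const _ (by fun_prop), lintegral_const_mul _ (by fun_prop),
          lintegral_exp_neg_quadratic_add_linear hD c hy, ih (by fun_prop) hD,
          ← ENNReal.ofReal_mul (by positivity), ← mul_assoc (ENNReal.ofReal _),
          ← mul_assoc (ENNReal.ofReal _), ← ENNReal.ofReal_mul (by positivity),
          ← ENNReal.ofReal_mul (by positivity)]
        simp_rw [mul_div_assoc]
        congr 2
        rw [Nat.triangle_succ, hs_def, sub_mul, neg_sub, sub_eq_add_neg, Real.exp_add, mul_comm q y]
        rw [← hd_def, ← hq_def]
        field_simp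
        ring_nf
    have hsucc := lintegral_hermParam_succ ((measurable_detExpTrace hF
      ((borderedMatrix b c D).submatrix (finSuccEquivUnitSum n) (finSuccEquivUnitSum n))).comp
      (continuous_toHermMatrix (n + 1)).measurable)
    simp only [Function.comp_apply] at hsucc
    rw [hsucc]
    simp_rw [hinner]
    rw [lintegral_indicator measurableSet_Ioi, lintegral_const_mul _ (by fun_prop), hdet,
      lintegral_detLaw_succ n (F := fun t => F (t / (d * s))) (by fun_prop)]
    have hH : Measurable fun y : ℝ => ENNReal.ofReal (y ^ n * Real.exp (-y)) *
        ∫⁻ t, F (y * t / (d * s)) ∂(detLaw n) :=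
      Measurable.mul (by fun_prop) (Measurable.lintegral_prod_right'
        (f := fun r : ℝ × ℝ => F (r.1 * r.2 / (d * s))) (by fun_prop))
    rw [lintegral_Ioi_comp_mul_left hs hH, ← mul_assoc, ← ENNReal.ofReal_mul (by positivity),
      ← lintegral_const_mul _ (by fun_prop), ← lintegral_const_mul _ (by fun_prop)]
    refine setLIntegral_congr_fun measurableSet_Ioi fun y hy => ?_
    have hy' : 0 < y := hy
    have harg : ∀ t, s * y * t / (d * s) = y * t / d := fun t => by field_simp
    simp only [harg]
    rw [← mul_assoc, ← mul_assoc, ← ENNReal.ofReal_mul (by positivity),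
      ← ENNReal.ofReal_mul (by positivity)]
    congr 2
    field_simp
    ring_nf

theorem measurable_abs_cpow (s : ℂ) : Measurable fun t : ℝ => ((|t| : ℝ) : ℂ) ^ s := by
  fun_prop

theorem gammaMeasureNat_density_smul (n : ℕ) (s : ℂ) {y : ℝ} (hy : 0 < y) :
    (Real.exp (-y) : ℂ) * (y : ℂ) ^ (s + n + 1 - 1) =
      (ENNReal.ofReal (y ^ n * Real.exp (-y))).toReal • ((|y| : ℝ) : ℂ) ^ s := by
  have hy' : (y : ℂ) ≠ 0 := Complex.ofReal_ne_zero.mpr hy.ne'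
  rw [ENNReal.toReal_ofReal (by positivity), abs_of_pos hy, add_sub_cancel_right,
    Complex.cpow_add _ _ hy', Complex.cpow_natCast, Complex.real_smul]
  push_cast
  ring

theorem integrable_abs_cpow_gammaMeasureNat (n : ℕ) {s : ℂ} (hs : -1 < s.re) :
    Integrable (fun t : ℝ => ((|t| : ℝ) : ℂ) ^ s) (gammaMeasureNat n) := by
  rw [gammaMeasureNat, integrable_withDensity_iff_integrable_smul' (by fun_prop) (by simp)]
  have hre : 0 < (s + n + 1).re := by
    have : (0 : ℝ) ≤ n := n.cast_nonneg
    simp only [Complex.add_re, Complex.natCast_re, Complex.one_re]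
    linarith
  exact (Complex.GammaIntegral_convergent hre).congr_fun
    (fun y hy => gammaMeasureNat_density_smul n s hy) measurableSet_Ioi

theorem integral_abs_cpow_gammaMeasureNat (n : ℕ) {s : ℂ} (hs : -1 < s.re) :
    ∫ t, ((|t| : ℝ) : ℂ) ^ s ∂(gammaMeasureNat n) = Complex.Gamma (s + n + 1) := by
  have hre : 0 < (s + n + 1).re := by
    have : (0 : ℝ) ≤ n := n.cast_nonneg
    simp only [Complex.add_re, Complex.natCast_re, Complex.one_re]
    linarith
  rw [gammaMeasureNat, integral_withDensity_eq_integral_toReal_smul (by fun_prop) (by simp),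
    Complex.Gamma_eq_integral hre, Complex.GammaIntegral]
  exact (setIntegral_congr_fun measurableSet_Ioi
    fun y hy => gammaMeasureNat_density_smul n s hy).symm

theorem abs_mul_cpow (x y : ℝ) (s : ℂ) :
    ((|x * y| : ℝ) : ℂ) ^ s = ((|x| : ℝ) : ℂ) ^ s * ((|y| : ℝ) : ℂ) ^ s := by
  rw [abs_mul, Complex.ofReal_mul, Complex.mul_cpow_ofReal_nonneg (abs_nonneg _) (abs_nonneg _)]

theorem integrable_abs_cpow_detLaw (n : ℕ) {s : ℂ} (hs : -1 < s.re) :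
    Integrable (fun t : ℝ => ((|t| : ℝ) : ℂ) ^ s) (detLaw n) := by
  induction n with
  | zero => exact integrable_dirac (by finiteness)
  | succ n ih =>
    rw [detLaw, integrable_map_measure (measurable_abs_cpow s).aestronglyMeasurable (by fun_prop)]
    simp only [Function.comp_def, abs_mul_cpow]
    exact (integrable_abs_cpow_gammaMeasureNat n hs).mul_prod ih

theorem integral_abs_cpow_detLaw (n : ℕ) {s : ℂ} (hs : -1 < s.re) :
    ∫ t, ((|t| : ℝ) : ℂ) ^ s ∂(detLaw n) = ∏ j : Fin n, Complex.Gamma (s + j + 1) := by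
  induction n with
  | zero => simp [detLaw]
  | succ n ih =>
    rw [detLaw, integral_map (by fun_prop) (measurable_abs_cpow s).aestronglyMeasurable]
    simp only [abs_mul_cpow]
    rw [integral_prod_mul (fun x : ℝ => ((|x| : ℝ) : ℂ) ^ s) (fun x : ℝ => ((|x| : ℝ) : ℂ) ^ s), ih,
      integral_abs_cpow_gammaMeasureNat n hs, Fin.prod_univ_castSucc, mul_comm]
    simp

/-- The measure `e^{-tr (B X)} dX` on the cone of positive definite matrices. -/
noncomputable def expTraceMeasure {n : ℕ} (B : Matrix (Fin n) (Fin n) ℂ) :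
    Measure (Matrix (Fin n) (Fin n) ℂ) :=
  ((hermLebesgue n).restrict {X | X.PosDef}).withDensity
    fun X => ENNReal.ofReal (Real.exp (-(trace (B * X)).re))

theorem map_det_re_expTraceMeasure {n : ℕ} {B : Matrix (Fin n) (Fin n) ℂ} (hB : B.PosDef) :
    (expTraceMeasure B).map (fun X => X.det.re) =
      ENNReal.ofReal (Real.pi ^ (n * (n - 1) / 2) / B.det.re ^ n) •
        (detLaw n).map fun t => t / B.det.re := by
  refine Measure.ext_of_lintegral _ fun F hF => ?_
  have hFm : Measurable fun X : Matrix (Fin n) (Fin n) ℂ => F X.det.re :=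
    hF.comp (measurable_det_re n)
  rw [lintegral_smul_measure, lintegral_map hF (measurable_det_re n), smul_eq_mul,
    lintegral_map hF (by fun_prop), ← lintegral_detExpTrace hF hB, expTraceMeasure,
    lintegral_withDensity_eq_lintegral_mul _ (measurable_exp_neg_trace_re B) hFm,
    ← lintegral_indicator (measurableSet_posDef n),
    hermLebesgue, (measurableEmbedding_toHermMatrix n).lintegral_map]
  refine lintegral_congr fun T => ?_
  rw [detExpTrace]
  simp only [Set.indicator, Pi.mul_apply, mul_comm]

theorem integrable_abs_det_cpow_expTraceMeasure {n : ℕ} {B : Matrix (Fin n) (Fin n) ℂ}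
    (hB : B.PosDef) {s : ℂ} (hs : -1 < s.re) :
    Integrable (fun X : Matrix (Fin n) (Fin n) ℂ => ((|X.det.re| : ℝ) : ℂ) ^ s)
      (expTraceMeasure B) := by
  have hm := (measurable_abs_cpow s).aestronglyMeasurable (μ := (expTraceMeasure B).map
    fun X => X.det.re)
  refine (integrable_map_measure hm (measurable_det_re n).aemeasurable).mp ?_
  rw [map_det_re_expTraceMeasure hB]
  refine Integrable.smul_measure ?_ ENNReal.ofReal_ne_top
  rw [integrable_map_measure (measurable_abs_cpow s).aestronglyMeasurable (by fun_prop)]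
  simp only [Function.comp_def, div_eq_mul_inv, abs_mul_cpow]
  exact (integrable_abs_cpow_detLaw n hs).mul_const _

theorem integral_abs_det_cpow_expTraceMeasure {n : ℕ} {B : Matrix (Fin n) (Fin n) ℂ}
    (hB : B.PosDef) {a : ℂ} (ha : (n - 1 : ℝ) < a.re) :
    ∫ X : Matrix (Fin n) (Fin n) ℂ, ((|X.det.re| : ℝ) : ℂ) ^ (a - n) ∂(expTraceMeasure B) =
      cGammaP n a * (B.det.re : ℂ) ^ (-a) := by
  have hs : -1 < (a - n).re := by
    rw [Complex.sub_re, Complex.natCast_re]; linarith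
  have hd := hB.det_re_pos
  have hd' : (B.det.re : ℂ) ≠ 0 := Complex.ofReal_ne_zero.mpr hd.ne'
  rw [← integral_map (measurable_det_re n).aemeasurable
    (measurable_abs_cpow (a - n)).aestronglyMeasurable, map_det_re_expTraceMeasure hB,
    integral_smul_measure, integral_map (by fun_prop)
    (measurable_abs_cpow (a - n)).aestronglyMeasurable]
  simp only [div_eq_mul_inv, abs_mul_cpow]
  rw [integral_mul_const, integral_abs_cpow_detLaw n hs, ENNReal.toReal_ofReal (by positivity),
    abs_of_pos (inv_pos.mpr hd), cGammaP, Complex.real_smul]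
  have hprod : ∏ j : Fin n, Complex.Gamma (a - n + j + 1) =
      ∏ j : Fin n, Complex.Gamma (a - j) := by
    rw [← Equiv.prod_comp Fin.revPerm]
    refine Finset.prod_congr rfl fun j _ => ?_
    have hj : ((Fin.rev j : ℕ) : ℂ) = n - (j + 1) := by
      rw [Fin.val_rev, Nat.cast_sub (by omega)]
      push_cast
      rfl
    rw [Fin.revPerm_apply, hj]
    congr 1
    ring
  have hpow : ((B.det.re⁻¹ : ℝ) : ℂ) ^ (a - n) = (B.det.re : ℂ) ^ (-a) * (B.det.re : ℂ) ^ n := by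
    rw [Complex.ofReal_inv, Complex.inv_cpow _ _ (by
      rw [Complex.arg_ofReal_of_nonneg hd.le]; exact Real.pi_ne_zero.symm), ← Complex.cpow_neg,
      neg_sub, sub_eq_neg_add, Complex.cpow_add _ _ hd', Complex.cpow_natCast]
  rw [hprod, hpow]
  push_cast
  field_simp

/-- Lebesgue measure on the cone of positive definite matrices. -/
noncomputable def posDefLebesgue (n : ℕ) : Measure (Matrix (Fin n) (Fin n) ℂ) :=
  (hermLebesgue n).restrict {X | X.PosDef}

instance sigmaFinite_posDefLebesgue (n : ℕ) : SigmaFinite (posDefLebesgue n) := by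
  unfold posDefLebesgue; infer_instance

theorem ae_posDefLebesgue (n : ℕ) : ∀ᵐ X ∂(posDefLebesgue n), X.PosDef :=
  ae_restrict_mem (measurableSet_posDef n)

/-- The integrand `e^{-tr (B X)} |det X|^{a - n}` of the matrix-variate gamma integral. -/
noncomputable def gammaKernel {n : ℕ} (a : ℂ) (B X : Matrix (Fin n) (Fin n) ℂ) : ℂ :=
  (Real.exp (-(trace (B * X)).re) : ℂ) * ((|X.det.re| : ℝ) : ℂ) ^ (a - n)

theorem toReal_exp_smul_eq_gammaKernel {n : ℕ} (a : ℂ) (B X : Matrix (Fin n) (Fin n) ℂ) :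
    (ENNReal.ofReal (Real.exp (-(trace (B * X)).re))).toReal •
      ((|X.det.re| : ℝ) : ℂ) ^ (a - n) = gammaKernel a B X := by
  rw [ENNReal.toReal_ofReal (Real.exp_nonneg _), Complex.real_smul, gammaKernel]

theorem integrable_gammaKernel {n : ℕ} {B : Matrix (Fin n) (Fin n) ℂ} (hB : B.PosDef) {a : ℂ}
    (ha : (n - 1 : ℝ) < a.re) : Integrable (gammaKernel a B) (posDefLebesgue n) := by
  have hs : -1 < (a - n).re := by
    rw [Complex.sub_re, Complex.natCast_re]; linarith
  have h := integrable_abs_det_cpow_expTraceMeasure hB hs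
  rw [expTraceMeasure, integrable_withDensity_iff_integrable_smul' (measurable_exp_neg_trace_re B)
    (by simp)] at h
  simp only [toReal_exp_smul_eq_gammaKernel] at h
  exact h

theorem integral_gammaKernel {n : ℕ} {B : Matrix (Fin n) (Fin n) ℂ} (hB : B.PosDef) {a : ℂ}
    (ha : (n - 1 : ℝ) < a.re) :
    ∫ X, gammaKernel a B X ∂(posDefLebesgue n) = cGammaP n a * (B.det.re : ℂ) ^ (-a) := by
  rw [← integral_abs_det_cpow_expTraceMeasure hB ha, expTraceMeasure,
    integral_withDensity_eq_integral_toReal_smul (measurable_exp_neg_trace_re B) (by simp)]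
  simp only [toReal_exp_smul_eq_gammaKernel]
  rfl

theorem ofReal_norm_gammaKernel {n : ℕ} (a : ℂ) (B : Matrix (Fin n) (Fin n) ℂ)
    {X : Matrix (Fin n) (Fin n) ℂ} (hX : X.PosDef) :
    ((‖gammaKernel a B X‖ : ℝ) : ℂ) = gammaKernel a.re B X := by
  have hd := hX.det_re_pos
  rw [gammaKernel, gammaKernel, norm_mul, Complex.norm_real, Real.norm_of_nonneg (Real.exp_nonneg _),
    abs_of_pos hd, Complex.norm_cpow_eq_rpow_re_of_pos hd, Complex.ofReal_mul,
    Complex.ofReal_cpow hd.le]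
  simp

theorem integral_norm_gammaKernel {n : ℕ} {B : Matrix (Fin n) (Fin n) ℂ} (hB : B.PosDef) {a : ℂ}
    (ha : (n - 1 : ℝ) < a.re) :
    ∫ X, ‖gammaKernel a B X‖ ∂(posDefLebesgue n) =
      ‖cGammaP n a.re‖ * ‖(B.det.re : ℂ) ^ (-a)‖ := by
  have h := integral_gammaKernel hB (a := a.re) (by simpa using ha)
  rw [← integral_congr_ae ((ae_posDefLebesgue n).mono fun X hX =>
    ofReal_norm_gammaKernel a B hX), integral_complex_ofReal] at h
  have h' := congrArg norm h
  rw [Complex.norm_real, Real.norm_of_nonneg (integral_nonneg fun X => norm_nonneg _),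
    norm_mul] at h'
  rw [h', Complex.norm_cpow_eq_rpow_re_of_pos hB.det_re_pos,
    Complex.norm_cpow_eq_rpow_re_of_pos hB.det_re_pos]
  simp

theorem measurable_gammaKernel {n : ℕ} (a : ℂ) :
    Measurable fun r : Matrix (Fin n) (Fin n) ℂ × Matrix (Fin n) (Fin n) ℂ =>
      gammaKernel a r.1 r.2 := by
  have h1 : Measurable fun r : Matrix (Fin n) (Fin n) ℂ × Matrix (Fin n) (Fin n) ℂ =>
      (trace (r.1 * r.2)).re := by
    simp only [trace, diag_apply, mul_apply]
    have hent : ∀ i j, Measurable fun M : Matrix (Fin n) (Fin n) ℂ => M i j := fun i j =>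
      Continuous.measurable (by fun_prop)
    refine Complex.measurable_re.comp (Finset.measurable_sum _ fun i _ =>
      Finset.measurable_sum _ fun j _ => ?_)
    exact ((hent i j).comp measurable_fst).mul ((hent j i).comp measurable_snd)
  have h2 : Measurable fun r : Matrix (Fin n) (Fin n) ℂ × Matrix (Fin n) (Fin n) ℂ =>
      ((|r.2.det.re| : ℝ) : ℂ) ^ (a - n) :=
    (measurable_abs_cpow (a - n)).comp ((measurable_det_re n).comp measurable_snd)
  exact (Complex.measurable_ofReal.comp (Real.measurable_exp.comp h1.neg)).mul h2

theorem gammaKernel_mul_cpow {n : ℕ} (a b : ℂ) (B : Matrix (Fin n) (Fin n) ℂ)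
    {X : Matrix (Fin n) (Fin n) ℂ} (hX : X.PosDef) :
    gammaKernel a B X * (X.det.re : ℂ) ^ b = gammaKernel (a + b) B X := by
  have hd := hX.det_re_pos
  rw [gammaKernel, gammaKernel, abs_of_pos hd, mul_assoc,
    ← Complex.cpow_add _ _ (Complex.ofReal_ne_zero.mpr hd.ne')]
  ring_nf

theorem prod_cpow_neg {ι : Type*} (s : Finset ι) (a : ι → ℂ) {x : ℂ} (hx : x ≠ 0) :
    ∏ j ∈ s, x ^ (-a j) = x ^ (-∑ j ∈ s, a j) := by
  classical
  induction s using Finset.induction_on with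
  | empty => simp
  | insert i s hi ih => rw [Finset.prod_insert hi, Finset.sum_insert hi, ih, neg_add,
      Complex.cpow_add _ _ hx]

section DirichletKernel

variable {n k : ℕ}

/-- The joint integrand whose two iterated integrals evaluate the type-2 Dirichlet integral. -/
noncomputable def dirichletKernel (a : Fin (k + 1) → ℂ) (Y : Matrix (Fin n) (Fin n) ℂ)
    (X : Fin k → Matrix (Fin n) (Fin n) ℂ) : ℂ :=
  gammaKernel (∑ j, a j) 1 Y * ∏ j, gammaKernel (a j.castSucc) Y (X j)

theorem measurable_dirichletKernel (a : Fin (k + 1) → ℂ) :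
    Measurable (Function.uncurry (dirichletKernel (n := n) a)) := by
  have h1 : Measurable fun r : Matrix (Fin n) (Fin n) ℂ × (Fin k → Matrix (Fin n) (Fin n) ℂ) =>
      gammaKernel (∑ j, a j) 1 r.1 :=
    (measurable_gammaKernel (∑ j, a j)).comp
      (f := fun r : Matrix (Fin n) (Fin n) ℂ × (Fin k → Matrix (Fin n) (Fin n) ℂ) => (1, r.1))
      (measurable_const.prodMk measurable_fst)
  have h2 : ∀ j : Fin k, Measurable fun r : Matrix (Fin n) (Fin n) ℂ ×
      (Fin k → Matrix (Fin n) (Fin n) ℂ) => gammaKernel (a j.castSucc) r.1 (r.2 j) := fun j =>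
    (measurable_gammaKernel (a j.castSucc)).comp
      (f := fun r : Matrix (Fin n) (Fin n) ℂ × (Fin k → Matrix (Fin n) (Fin n) ℂ) => (r.1, r.2 j))
      (measurable_fst.prodMk ((measurable_pi_apply j).comp measurable_snd))
  exact h1.mul (Finset.measurable_fun_prod _ fun j _ => h2 j)

theorem gammaKernel_mul_prod_cpow (a : Fin (k + 1) → ℂ) {Y : Matrix (Fin n) (Fin n) ℂ}
    (hY : Y.PosDef) :
    gammaKernel (∑ j, a j) 1 Y * ∏ j : Fin k, (Y.det.re : ℂ) ^ (-a j.castSucc) =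
      gammaKernel (a (Fin.last k)) 1 Y := by
  rw [prod_cpow_neg _ _ (Complex.ofReal_ne_zero.mpr hY.det_re_pos.ne'),
    gammaKernel_mul_cpow _ _ _ hY, Fin.sum_univ_castSucc]
  congr 1
  ring

theorem integral_dirichletKernel_right (a : Fin (k + 1) → ℂ) (ha : ∀ j, (n - 1 : ℝ) < (a j).re)
    {Y : Matrix (Fin n) (Fin n) ℂ} (hY : Y.PosDef) :
    ∫ X, dirichletKernel a Y X ∂(Measure.pi fun _ => posDefLebesgue n) =
      (∏ j : Fin k, cGammaP n (a j.castSucc)) * gammaKernel (a (Fin.last k)) 1 Y := by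
  simp only [dirichletKernel]
  rw [integral_const_mul, integral_fintype_prod_eq_prod,
    Finset.prod_congr rfl fun j _ => integral_gammaKernel hY (ha (Fin.castSucc j)),
    Finset.prod_mul_distrib, mul_left_comm, gammaKernel_mul_prod_cpow a hY]

theorem integral_norm_dirichletKernel_right (a : Fin (k + 1) → ℂ)
    (ha : ∀ j, (n - 1 : ℝ) < (a j).re) {Y : Matrix (Fin n) (Fin n) ℂ} (hY : Y.PosDef) :
    ∫ X, ‖dirichletKernel a Y X‖ ∂(Measure.pi fun _ => posDefLebesgue n) =
      (∏ j : Fin k, ‖cGammaP n (a j.castSucc).re‖) * ‖gammaKernel (a (Fin.last k)) 1 Y‖ := by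
  simp only [dirichletKernel, norm_mul, norm_prod]
  rw [integral_const_mul,
    integral_fintype_prod_eq_prod (fun (j : Fin k) X => ‖gammaKernel (a j.castSucc) Y X‖),
    Finset.prod_congr rfl fun j _ => integral_norm_gammaKernel hY (ha (Fin.castSucc j)),
    Finset.prod_mul_distrib, mul_left_comm, ← gammaKernel_mul_prod_cpow a hY, norm_mul,
    norm_prod]

theorem integrable_dirichletKernel (a : Fin (k + 1) → ℂ) (ha : ∀ j, (n - 1 : ℝ) < (a j).re) :
    Integrable (Function.uncurry (dirichletKernel (n := n) a))
      ((posDefLebesgue n).prod (Measure.pi fun _ => posDefLebesgue n)) := by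
  rw [integrable_prod_iff (measurable_dirichletKernel a).aestronglyMeasurable]
  constructor
  · filter_upwards [ae_posDefLebesgue n] with Y hY
    exact (Integrable.fintype_prod fun j : Fin k =>
      integrable_gammaKernel hY (ha j.castSucc)).const_mul (gammaKernel (∑ j, a j) 1 Y)
  · refine ((integrable_gammaKernel PosDef.one (ha (Fin.last k))).norm.const_mul
      (∏ j : Fin k, ‖cGammaP n (a j.castSucc).re‖)).congr ?_
    filter_upwards [ae_posDefLebesgue n] with Y hY
    exact (integral_norm_dirichletKernel_right a ha hY).symm

theorem posDef_one_add_sum {X : Fin k → Matrix (Fin n) (Fin n) ℂ} (hX : ∀ j, (X j).PosDef) :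
    (1 + ∑ j, X j).PosDef :=
  PosDef.one.add_posSemidef (posSemidef_sum _ fun j _ => (hX j).posSemidef)

theorem dirichletKernel_eq (a : Fin (k + 1) → ℂ) (Y : Matrix (Fin n) (Fin n) ℂ)
    (X : Fin k → Matrix (Fin n) (Fin n) ℂ) :
    dirichletKernel a Y X = gammaKernel (∑ j, a j) (1 + ∑ j, X j) Y *
      ∏ j, ((|(X j).det.re| : ℝ) : ℂ) ^ (a j.castSucc - n) := by
  have htr : (trace ((1 + ∑ j, X j) * Y)).re =
      (trace (1 * Y)).re + ∑ j, (trace (Y * X j)).re := by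
    rw [add_mul, trace_add, Finset.sum_mul, trace_sum, Complex.add_re, Complex.re_sum]
    simp only [trace_mul_comm Y]
  simp only [dirichletKernel, gammaKernel]
  rw [Finset.prod_mul_distrib, htr, neg_add, Real.exp_add, ← Finset.sum_neg_distrib,
    Real.exp_sum]
  push_cast
  ring

theorem integral_dirichletKernel_left (a : Fin (k + 1) → ℂ) (ha : (n - 1 : ℝ) < (∑ j, a j).re)
    {X : Fin k → Matrix (Fin n) (Fin n) ℂ} (hX : ∀ j, (X j).PosDef) :
    ∫ Y, dirichletKernel a Y X ∂(posDefLebesgue n) =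
      cGammaP n (∑ j, a j) * ((∏ j, ((X j).det.re : ℂ) ^ (a j.castSucc - n)) *
        ((1 + ∑ j, X j).det.re : ℂ) ^ (-∑ j, a j)) := by
  simp only [dirichletKernel_eq]
  rw [integral_mul_const, integral_gammaKernel (posDef_one_add_sum hX) ha,
    Finset.prod_congr rfl fun j _ => by rw [abs_of_pos (hX j).det_re_pos]]
  ring

theorem setOf_forall_posDef :
    {X : Fin k → Matrix (Fin n) (Fin n) ℂ | ∀ j, (X j).PosDef} =
      Set.univ.pi fun _ => {X | X.PosDef} := by
  ext X; simp

theorem pi_posDefLebesgue :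
    Measure.pi (fun _ : Fin k => posDefLebesgue n) =
      (Measure.pi fun _ : Fin k => hermLebesgue n).restrict {X | ∀ j, (X j).PosDef} := by
  rw [setOf_forall_posDef, Measure.restrict_pi_pi]
  rfl

theorem measurableSet_forall_posDef :
    MeasurableSet {X : Fin k → Matrix (Fin n) (Fin n) ℂ | ∀ j, (X j).PosDef} := by
  rw [setOf_forall_posDef]
  exact MeasurableSet.univ_pi fun _ => measurableSet_posDef n

/-- The complex matrix-variate type-2 Dirichlet integral. -/
theorem integral_dirichlet_type_two (a : Fin (k + 1) → ℂ) (ha : ∀ j, (n - 1 : ℝ) < (a j).re)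
    (hsum : (n - 1 : ℝ) < (∑ j, a j).re) :
    cGammaP n (∑ j, a j) * ∫ X in {X : Fin k → Matrix (Fin n) (Fin n) ℂ | ∀ j, (X j).PosDef},
      (∏ j, ((X j).det.re : ℂ) ^ (a j.castSucc - n)) *
        ((1 + ∑ j, X j).det.re : ℂ) ^ (-∑ j, a j) ∂(Measure.pi fun _ => hermLebesgue n) =
      ∏ j, cGammaP n (a j) := by
  have hswap := integral_integral_swap (integrable_dirichletKernel a ha)
  rw [integral_congr_ae ((ae_posDefLebesgue n).mono fun Y hY =>
    integral_dirichletKernel_right a ha hY), integral_const_mul,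
    integral_gammaKernel PosDef.one (ha (Fin.last k)), pi_posDefLebesgue,
    setIntegral_congr_fun measurableSet_forall_posDef
      (fun X hX => integral_dirichletKernel_left a hsum hX), integral_const_mul] at hswap
  rw [← hswap, Fin.prod_univ_castSucc]
  simp

end DirichletKernel

theorem stmt13 (p k : ℕ) (hp : 1 ≤ p) (hk : 1 ≤ k)
    (α : Fin (k + 1) → ℂ) (γ : Fin k → ℂ)
    (hα : ∀ j, (p - 1 : ℝ) < (α j).re)
    (hαγ : ∀ j : Fin k, (p - 1 : ℝ) < (α j.castSucc + γ j).re)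
    (hγ : (p - 1 : ℝ) < (α (Fin.last k) - ∑ j, γ j).re) :
    ∫ X in {X : Fin k → Matrix (Fin p) (Fin p) ℂ | ∀ j, (X j).PosDef},
      ((∏ j : Fin k, ((X j).det.re : ℂ) ^ (γ j)) *
        ((cGammaP p (∑ j, α j) / ∏ j : Fin (k + 1), cGammaP p (α j)) *
          (∏ j : Fin k, ((X j).det.re : ℂ) ^ (α j.castSucc - p)) *
          (((1 + ∑ j, X j).det.re : ℂ) ^ (-(∑ j, α j)))))
      ∂(Measure.pi fun _ : Fin k => hermLebesgue p)
    = (∏ j : Fin k, cGammaP p (α j.castSucc + γ j) / cGammaP p (α j.castSucc)) *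
        cGammaP p (α (Fin.last k) - ∑ j, γ j) / cGammaP p (α (Fin.last k)) := by
  set a : Fin (k + 1) → ℂ :=
    Fin.snoc (fun j => α j.castSucc + γ j) (α (Fin.last k) - ∑ j, γ j) with ha_def
  have hac : ∀ j : Fin k, a j.castSucc = α j.castSucc + γ j := fun j => by simp [ha_def]
  have hal : a (Fin.last k) = α (Fin.last k) - ∑ j, γ j := by simp [ha_def]
  have hsum : ∑ j, a j = ∑ j, α j := by
    simp only [Fin.sum_univ_castSucc, hac, hal, Finset.sum_add_distrib]
    ring
  have ha : ∀ j, (p - 1 : ℝ) < (a j).re :=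
    Fin.lastCases (by rw [hal]; exact hγ) fun j => by rw [hac]; exact hαγ j
  have hp' : (1 : ℝ) ≤ p := by exact_mod_cast hp
  have hA : (p - 1 : ℝ) < (∑ j, α j).re := by
    rw [Complex.re_sum, Fin.sum_univ_castSucc]
    have h0 : 0 ≤ ∑ j : Fin k, (α j.castSucc).re :=
      Finset.sum_nonneg fun j _ => by have := hα j.castSucc; linarith
    have := hα (Fin.last k)
    linarith
  have key := integral_dirichlet_type_two a ha (hsum ▸ hA)
  have hint : ∀ X ∈ {X : Fin k → Matrix (Fin p) (Fin p) ℂ | ∀ j, (X j).PosDef},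
      (∏ j : Fin k, ((X j).det.re : ℂ) ^ (γ j)) *
        ((cGammaP p (∑ j, α j) / ∏ j : Fin (k + 1), cGammaP p (α j)) *
          (∏ j : Fin k, ((X j).det.re : ℂ) ^ (α j.castSucc - p)) *
          (((1 + ∑ j, X j).det.re : ℂ) ^ (-(∑ j, α j)))) =
      (cGammaP p (∑ j, α j) / ∏ j : Fin (k + 1), cGammaP p (α j)) *
        ((∏ j, ((X j).det.re : ℂ) ^ (a j.castSucc - p)) *
          ((1 + ∑ j, X j).det.re : ℂ) ^ (-∑ j, a j)) := by
    intro X hX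
    have hprod : ∏ j, ((X j).det.re : ℂ) ^ (a j.castSucc - p) =
        (∏ j : Fin k, ((X j).det.re : ℂ) ^ (γ j)) *
          ∏ j : Fin k, ((X j).det.re : ℂ) ^ (α j.castSucc - p) := by
      rw [← Finset.prod_mul_distrib]
      refine Finset.prod_congr rfl fun j _ => ?_
      rw [← Complex.cpow_add _ _ (Complex.ofReal_ne_zero.mpr (hX j).det_re_pos.ne'), hac]
      congr 1
      ring
    rw [hprod, hsum]
    ring
  rw [setIntegral_congr_fun measurableSet_forall_posDef hint, integral_const_mul,
    div_mul_eq_mul_div, ← hsum, key, Finset.prod_div_distrib]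
  simp only [Fin.prod_univ_castSucc, hac, hal]
  rw [div_mul_eq_mul_div, div_div]
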